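/- arXiv:2305.18040 — 2 statements merged into one kernel-verified Lean document; each statement's English description precedes it below -/
import Mathlib

section
/- Assume in addition that H·ξ = 0. Then det(τ·Id₈ + A(ξ)) = τ⁶·(τ² − (c² + h²)|ξ|²) for every τ ∈ ℝ. In particular, when ξ ≠ 0, H ≠ 0 and γp > 0, the eigenvalue 0 of A(ξ) has algebraic multiplicity 6 and ±√(c²+h²)·|ξ| are simple eigenvalues. -/
open Matrix

noncomputable section

/-- Euclidean dot product on `ℝ³`. -/
def dot3 (a b : Fin 3 → ℝ) : ℝ := a 0 * b 0 + a 1 * b 1 + a 2 * b 2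

/-- Cross product on `ℝ³`. -/
def cross3 (a b : Fin 3 → ℝ) : Fin 3 → ℝ :=
  ![a 1 * b 2 - a 2 * b 1, a 2 * b 0 - a 0 * b 2, a 0 * b 1 - a 1 * b 0]

/-- The sound speed squared `c² = γp/ρ`. -/
def csq (ρ γ p : ℝ) : ℝ := γ * p / ρ

/-- The Alfvén speed squared `h² = |H|²/ρ`. -/
def hsq (ρ : ℝ) (H : Fin 3 → ℝ) : ℝ := dot3 H H / ρ

/-- `b²(ξ) = |ξ×H|²/ρ`. -/
def bsq (ρ : ℝ) (H ξ : Fin 3 → ℝ) : ℝ := dot3 (cross3 ξ H) (cross3 ξ H) / ρ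

/-- The slow magnetosonic speed squared `c_s²(ξ)`. -/
def cs2 (ρ γ p : ℝ) (H ξ : Fin 3 → ℝ) : ℝ :=
  ((csq ρ γ p + hsq ρ H) * dot3 ξ ξ
    - Real.sqrt ((csq ρ γ p - hsq ρ H) ^ 2 * (dot3 ξ ξ) ^ 2
        + 4 * bsq ρ H ξ * csq ρ γ p * dot3 ξ ξ)) / 2

/-- The fast magnetosonic speed squared `c_f²(ξ)`. -/
def cf2 (ρ γ p : ℝ) (H ξ : Fin 3 → ℝ) : ℝ :=
  ((csq ρ γ p + hsq ρ H) * dot3 ξ ξ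
    + Real.sqrt ((csq ρ γ p - hsq ρ H) ^ 2 * (dot3 ξ ξ) ^ 2
        + 4 * bsq ρ H ξ * csq ρ γ p * dot3 ξ ξ)) / 2

/-- The matrix `A(ξ) = q(0,ξ)` of the principal symbol of the linearized ideal
MHD system in the coordinates `(ρ̇,u̇₁,u̇₂,u̇₃,Ḣ₁,Ḣ₂,Ḣ₃,ṗ)`, so that
`q(τ,ξ) = τ·Id₈ + A(ξ)`. -/
def Amat (ρ γ p : ℝ) (H ξ : Fin 3 → ℝ) : Matrix (Fin 8) (Fin 8) ℝ :=
  !![0, ρ * ξ 0, ρ * ξ 1, ρ * ξ 2, 0, 0, 0, 0;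
     0, 0, 0, 0, (ξ 0 * H 0 - dot3 H ξ) / ρ, (ξ 0 * H 1) / ρ, (ξ 0 * H 2) / ρ, ξ 0 / ρ;
     0, 0, 0, 0, (ξ 1 * H 0) / ρ, (ξ 1 * H 1 - dot3 H ξ) / ρ, (ξ 1 * H 2) / ρ, ξ 1 / ρ;
     0, 0, 0, 0, (ξ 2 * H 0) / ρ, (ξ 2 * H 1) / ρ, (ξ 2 * H 2 - dot3 H ξ) / ρ, ξ 2 / ρ;
     0, H 0 * ξ 0 - dot3 H ξ, H 0 * ξ 1, H 0 * ξ 2, 0, 0, 0, 0;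
     0, H 1 * ξ 0, H 1 * ξ 1 - dot3 H ξ, H 1 * ξ 2, 0, 0, 0, 0;
     0, H 2 * ξ 0, H 2 * ξ 1, H 2 * ξ 2 - dot3 H ξ, 0, 0, 0, 0;
     0, γ * p * ξ 0, γ * p * ξ 1, γ * p * ξ 2, 0, 0, 0, 0]

open Polynomial in
/-- The charpoly of a product of an `8 × 2` and a `2 × 8` matrix whose reversed product is
antidiagonal. -/
lemma charpoly_mul_of_antidiagonal (U : Matrix (Fin 8) (Fin 2) ℝ) (V : Matrix (Fin 2) (Fin 8) ℝ)
    (a b : ℝ) (h : V * U = !![0, a; b, 0]) :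
    (U * V).charpoly = X ^ 6 * (X ^ 2 - C (a * b)) := by
  have key := Matrix.charpoly_mul_comm' U V
  have hVU : (V * U).charpoly = X ^ 2 - C (a * b) := by
    rw [h, Matrix.charpoly_fin_two]
    simp [Matrix.trace_fin_two, Matrix.det_fin_two]
    ring
  rw [hVU] at key
  simp only [Fintype.card_fin] at key
  refine mul_left_cancel₀ (pow_ne_zero 2 (X_ne_zero (R := ℝ))) ?_
  rw [key, ← mul_assoc, ← pow_add]

open Polynomial in
lemma Amat_charpoly (ρ γ p : ℝ) (H ξ : Fin 3 → ℝ) (hHξ : dot3 H ξ = 0) :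
    (Amat ρ γ p H ξ).charpoly
      = X ^ 6 * (X ^ 2 - C ((csq ρ γ p + hsq ρ H) * dot3 ξ ξ)) := by
  let U : Matrix (Fin 8) (Fin 2) ℝ :=
    !![ρ, 0; 0, ξ 0; 0, ξ 1; 0, ξ 2; H 0, 0; H 1, 0; H 2, 0; γ * p, 0]
  let V : Matrix (Fin 2) (Fin 8) ℝ :=
    !![0, ξ 0, ξ 1, ξ 2, 0, 0, 0, 0; 0, 0, 0, 0, H 0 / ρ, H 1 / ρ, H 2 / ρ, 1 / ρ]
  have hA : Amat ρ γ p H ξ = U * V := by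
    unfold Amat
    rw [hHξ]
    ext i j
    fin_cases i <;> fin_cases j <;>
      simp [U, V, Matrix.mul_apply, Fin.sum_univ_two] <;> ring
  have hVU : V * U = !![0, dot3 ξ ξ; csq ρ γ p + hsq ρ H, 0] := by
    ext i j
    fin_cases i <;> fin_cases j <;>
      simp [U, V, Matrix.mul_apply, Fin.sum_univ_eight, dot3, csq, hsq]
    ring
  rw [hA, charpoly_mul_of_antidiagonal U V _ _ hVU, mul_comm (dot3 ξ ξ)]

lemma dot3_self_pos {v : Fin 3 → ℝ} (hv : v ≠ 0) : 0 < dot3 v v := by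
  have h : dot3 v v = v ⬝ᵥ v := by simp [dot3, dotProduct, Fin.sum_univ_three]
  rw [h]
  exact (Finset.sum_nonneg fun i _ => mul_self_nonneg (v i)).lt_of_ne'
    (mt dotProduct_self_eq_zero.mp hv)

open Polynomial in
lemma roots_X_pow_six_mul (r : ℝ) :
    (X ^ 6 * (X ^ 2 - C (r ^ 2)) : ℝ[X]).roots
      = Multiset.replicate 6 0 + ({r} + {-r}) := by
  have h : (X ^ 6 * (X ^ 2 - C (r ^ 2)) : ℝ[X]) = X ^ 6 * ((X - C r) * (X - C (-r))) := by
    simp only [map_neg, map_pow]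
    ring
  have h2 : ((X - C r) * (X - C (-r)) : ℝ[X]) ≠ 0 :=
    mul_ne_zero (X_sub_C_ne_zero _) (X_sub_C_ne_zero _)
  rw [h, roots_mul (mul_ne_zero (pow_ne_zero 6 X_ne_zero) h2), roots_mul h2, roots_X_sub_C,
    roots_X_sub_C, roots_X_pow, Multiset.nsmul_singleton]

/-- If `H·ξ = 0` then `det(τ·Id₈ + A(ξ)) = τ⁶·(τ² − (c²+h²)|ξ|²)`.
In particular, when `ξ ≠ 0`, `H ≠ 0` and `γp > 0`, the eigenvalue `0` of `A(ξ)`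
has algebraic multiplicity `6` and `±√(c²+h²)·|ξ|` are simple eigenvalues. -/
theorem stmt12 (ρ γ p : ℝ) (H ξ : Fin 3 → ℝ)
    (hρ : 0 < ρ) (hHξ : dot3 H ξ = 0) :
    (∀ τ : ℝ,
      (τ • (1 : Matrix (Fin 8) (Fin 8) ℝ) + Amat ρ γ p H ξ).det
        = τ ^ 6 * (τ ^ 2 - (csq ρ γ p + hsq ρ H) * dot3 ξ ξ)) ∧
    (ξ ≠ 0 → H ≠ 0 → 0 < γ * p →
      Polynomial.rootMultiplicity 0 (Amat ρ γ p H ξ).charpoly = 6 ∧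
      Polynomial.rootMultiplicity
          (Real.sqrt (csq ρ γ p + hsq ρ H) * Real.sqrt (dot3 ξ ξ))
          (Amat ρ γ p H ξ).charpoly = 1 ∧
      Polynomial.rootMultiplicity
          (-(Real.sqrt (csq ρ γ p + hsq ρ H) * Real.sqrt (dot3 ξ ξ)))
          (Amat ρ γ p H ξ).charpoly = 1) := by
  have hchar := Amat_charpoly ρ γ p H ξ hHξ
  refine ⟨fun τ => ?_, fun hξ hH hp => ?_⟩
  · have hdet := congrArg (Polynomial.eval (-τ)) hchar
    rw [Matrix.eval_charpoly] at hdet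
    have hneg : Matrix.scalar (Fin 8) (-τ) - Amat ρ γ p H ξ
        = -(τ • (1 : Matrix (Fin 8) (Fin 8) ℝ) + Amat ρ γ p H ξ) := by
      rw [Matrix.scalar_apply, ← Matrix.smul_one_eq_diagonal, neg_smul]
      abel
    rw [hneg, Matrix.det_neg, Fintype.card_fin] at hdet
    simp only [Polynomial.eval_mul, Polynomial.eval_pow, Polynomial.eval_sub, Polynomial.eval_X,
      Polynomial.eval_C] at hdet
    linear_combination hdet
  · have hs : 0 < csq ρ γ p + hsq ρ H :=
      add_pos (div_pos hp hρ) (div_pos (dot3_self_pos hH) hρ)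
    have hd := dot3_self_pos hξ
    have hrsq : (csq ρ γ p + hsq ρ H) * dot3 ξ ξ
        = (Real.sqrt (csq ρ γ p + hsq ρ H) * Real.sqrt (dot3 ξ ξ)) ^ 2 := by
      rw [mul_pow, Real.sq_sqrt hs.le, Real.sq_sqrt hd.le]
    have hr := mul_pos (Real.sqrt_pos.mpr hs) (Real.sqrt_pos.mpr hd)
    rw [hrsq] at hchar
    generalize Real.sqrt (csq ρ γ p + hsq ρ H) * Real.sqrt (dot3 ξ ξ) = r at hchar hr ⊢
    have hr0 : r ≠ 0 := hr.ne'
    have hrr : r ≠ -r := by linarith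
    simp only [← Polynomial.count_roots, hchar, roots_X_pow_six_mul, Multiset.count_add,
      Multiset.count_replicate, Multiset.count_singleton]
    simp [hr0, hr0.symm, hrr, hrr.symm]
end
end

section
/- Assume in addition that 0 < |H|², |H|² ≠ γp, H·ξ ≠ 0 and ξ×H ≠ 0. Then the characteristic polynomial det(τ·Id₈ + A(ξ)) ∈ ℝ[τ] equals τ²·(τ² − c_s²(ξ))·(τ² − (H·ξ)²/ρ)·(τ² − c_f²(ξ)), the six real numbers ±√(c_s²(ξ)), ±(H·ξ)/√ρ, ±√(c_f²(ξ)) are nonzero and pairwise distinct, 0 is a root of algebraic multiplicity exactly 2, and every nonzero root is simple. -/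
open Matrix

noncomputable section

/-- Lagrange's identity on `ℝ³`. -/
lemma dot3_cross3_self (a b : Fin 3 → ℝ) :
    dot3 (cross3 a b) (cross3 a b) = dot3 b b * dot3 a a - dot3 b a ^ 2 := by
  simp only [dot3, cross3, Matrix.cons_val]
  ring

lemma dot3_self_nonneg (a : Fin 3 → ℝ) : 0 ≤ dot3 a a := by
  unfold dot3
  nlinarith [mul_self_nonneg (a 0), mul_self_nonneg (a 1), mul_self_nonneg (a 2)]

lemma dot3_self_pos_s18 {a : Fin 3 → ℝ} (ha : a ≠ 0) : 0 < dot3 a a := by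
  refine lt_of_le_of_ne (dot3_self_nonneg a) fun h => ha ?_
  unfold dot3 at h
  have h0 := mul_self_nonneg (a 0)
  have h1 := mul_self_nonneg (a 1)
  have h2 := mul_self_nonneg (a 2)
  funext i
  fin_cases i
  · exact mul_self_eq_zero.mp (show a 0 * a 0 = 0 by linarith)
  · exact mul_self_eq_zero.mp (show a 1 * a 1 = 0 by linarith)
  · exact mul_self_eq_zero.mp (show a 2 * a 2 = 0 by linarith)

lemma discriminant_nonneg {ρ γ p : ℝ} (H ξ : Fin 3 → ℝ) (hρ : 0 < ρ) (hγp : 0 < γ * p) :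
    0 ≤ (csq ρ γ p - hsq ρ H) ^ 2 * (dot3 ξ ξ) ^ 2
        + 4 * bsq ρ H ξ * csq ρ γ p * dot3 ξ ξ := by
  have hξ := dot3_self_nonneg ξ
  have hb : 0 ≤ bsq ρ H ξ := div_nonneg (dot3_self_nonneg _) hρ.le
  have hc : 0 ≤ csq ρ γ p := (div_pos hγp hρ).le
  positivity

lemma cs2_add_cf2 (ρ γ p : ℝ) (H ξ : Fin 3 → ℝ) :
    cs2 ρ γ p H ξ + cf2 ρ γ p H ξ = (csq ρ γ p + hsq ρ H) * dot3 ξ ξ := by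
  unfold cs2 cf2
  ring

lemma cs2_mul_cf2 {ρ γ p : ℝ} (H ξ : Fin 3 → ℝ) (hρ : 0 < ρ) (hγp : 0 < γ * p) :
    cs2 ρ γ p H ξ * cf2 ρ γ p H ξ = csq ρ γ p * (dot3 H ξ ^ 2 / ρ) * dot3 ξ ξ := by
  have hs := Real.sq_sqrt (discriminant_nonneg H ξ hρ hγp)
  have hb : bsq ρ H ξ = hsq ρ H * dot3 ξ ξ - dot3 H ξ ^ 2 / ρ := by
    unfold bsq hsq
    rw [dot3_cross3_self]
    ring
  unfold cs2 cf2
  rw [hb] at hs ⊢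
  linear_combination (-1 / 4) * hs

lemma cs2_le_cf2 (ρ γ p : ℝ) (H ξ : Fin 3 → ℝ) : cs2 ρ γ p H ξ ≤ cf2 ρ γ p H ξ := by
  unfold cs2 cf2
  linarith [Real.sqrt_nonneg ((csq ρ γ p - hsq ρ H) ^ 2 * (dot3 ξ ξ) ^ 2
        + 4 * bsq ρ H ξ * csq ρ γ p * dot3 ξ ξ)]

/-- The Alfvén speed lies strictly between the slow and the fast magnetosonic speeds. -/
lemma magnetosonic_speeds_lt {ρ γ p : ℝ} {H ξ : Fin 3 → ℝ} (hρ : 0 < ρ) (hγp : 0 < γ * p)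
    (hHξ : dot3 H ξ ≠ 0) (hcross : cross3 ξ H ≠ 0) :
    0 < cs2 ρ γ p H ξ ∧ cs2 ρ γ p H ξ < dot3 H ξ ^ 2 / ρ ∧
      dot3 H ξ ^ 2 / ρ < cf2 ρ γ p H ξ := by
  have hsum := cs2_add_cf2 ρ γ p H ξ
  have hmul := cs2_mul_cf2 H ξ hρ hγp
  have hle := cs2_le_cf2 ρ γ p H ξ
  have ha : 0 < dot3 H ξ ^ 2 / ρ := by positivity
  have hc : 0 < csq ρ γ p := div_pos hγp hρ
  have hξ : 0 < dot3 ξ ξ := dot3_self_pos_s18 fun h => hHξ (by simp [h, dot3])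
  have hb : 0 < hsq ρ H * dot3 ξ ξ - dot3 H ξ ^ 2 / ρ := by
    have h : hsq ρ H * dot3 ξ ξ - dot3 H ξ ^ 2 / ρ = dot3 (cross3 ξ H) (cross3 ξ H) / ρ := by
      rw [dot3_cross3_self, hsq]
      ring
    exact h ▸ div_pos (dot3_self_pos_s18 hcross) hρ
  set a := dot3 H ξ ^ 2 / ρ
  set s := cs2 ρ γ p H ξ
  set f := cf2 ρ γ p H ξ
  have hneg : (a - s) * (a - f) < 0 := by
    have : (a - s) * (a - f) = -(a * (hsq ρ H * dot3 ξ ξ - a)) := by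
      linear_combination (-a) * hsum + hmul
    rw [this]
    exact neg_neg_of_pos (mul_pos ha hb)
  have hprod : 0 < s * f := by
    rw [hmul]
    positivity
  rcases mul_neg_iff.mp hneg with ⟨h1, h2⟩ | ⟨h1, h2⟩
  · have hf : 0 < f := by linarith
    exact ⟨pos_of_mul_pos_left hprod hf.le, by linarith, by linarith⟩
  · linarith

/-- The velocity components of the symbol, as a block acting on `(Ḣ₁,Ḣ₂,Ḣ₃,ṗ,ρ̇)`. -/
def velocityBlock (ρ : ℝ) (H ξ : Fin 3 → ℝ) : Matrix (Fin 3) (Fin 5) ℝ :=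
  !![(ξ 0 * H 0 - dot3 H ξ) / ρ, (ξ 0 * H 1) / ρ, (ξ 0 * H 2) / ρ, ξ 0 / ρ, 0;
     (ξ 1 * H 0) / ρ, (ξ 1 * H 1 - dot3 H ξ) / ρ, (ξ 1 * H 2) / ρ, ξ 1 / ρ, 0;
     (ξ 2 * H 0) / ρ, (ξ 2 * H 1) / ρ, (ξ 2 * H 2 - dot3 H ξ) / ρ, ξ 2 / ρ, 0]

/-- The `(Ḣ₁,Ḣ₂,Ḣ₃,ṗ,ρ̇)` components of the symbol, as a block acting on the velocity. -/
def fieldBlock (ρ γ p : ℝ) (H ξ : Fin 3 → ℝ) : Matrix (Fin 5) (Fin 3) ℝ :=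
  !![H 0 * ξ 0 - dot3 H ξ, H 0 * ξ 1, H 0 * ξ 2;
     H 1 * ξ 0, H 1 * ξ 1 - dot3 H ξ, H 1 * ξ 2;
     H 2 * ξ 0, H 2 * ξ 1, H 2 * ξ 2 - dot3 H ξ;
     γ * p * ξ 0, γ * p * ξ 1, γ * p * ξ 2;
     ρ * ξ 0, ρ * ξ 1, ρ * ξ 2]

lemma velocityBlock_mul_fieldBlock (ρ γ p : ℝ) (H ξ : Fin 3 → ℝ) :
    velocityBlock ρ H ξ * fieldBlock ρ γ p H ξ = Matrix.of fun i j =>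
      (dot3 H ξ ^ 2 * (1 : Matrix (Fin 3) (Fin 3) ℝ) i j - dot3 H ξ * (ξ i * H j + H i * ξ j)
        + (γ * p + dot3 H H) * ξ i * ξ j) / ρ := by
  ext i j
  fin_cases i <;> fin_cases j <;>
    simp [velocityBlock, fieldBlock, Matrix.mul_apply, Fin.sum_univ_succ, dot3] <;> ring

/-- Moves the density component behind the others and splits off the velocity. -/
def velocityEquiv : Fin 3 ⊕ Fin 5 ≃ Fin 8 where
  toFun := Sum.elim ![1, 2, 3] ![4, 5, 6, 7, 0]
  invFun := ![.inr 4, .inl 0, .inl 1, .inl 2, .inr 0, .inr 1, .inr 2, .inr 3]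
  left_inv := by decide
  right_inv := by decide

lemma submatrix_velocityEquiv (ρ γ p τ : ℝ) (H ξ : Fin 3 → ℝ) :
    (τ • (1 : Matrix (Fin 8) (Fin 8) ℝ) + Amat ρ γ p H ξ).submatrix velocityEquiv velocityEquiv
      = Matrix.fromBlocks (τ • 1) (velocityBlock ρ H ξ) (fieldBlock ρ γ p H ξ) (τ • 1) := by
  rw [Matrix.submatrix_add, Pi.add_apply, Pi.add_apply, Matrix.submatrix_smul, Pi.smul_apply,
    Pi.smul_apply, Matrix.submatrix_one_equiv, ← Matrix.fromBlocks_one, Matrix.fromBlocks_smul,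
    smul_zero, smul_zero, ← Matrix.fromBlocks_toBlocks ((Amat ρ γ p H ξ).submatrix _ _),
    Matrix.fromBlocks_add]
  congr 1
  all_goals
    ext i j
    fin_cases i <;> fin_cases j <;>
      simp [Matrix.toBlocks₁₁, Matrix.toBlocks₁₂, Matrix.toBlocks₂₁, Matrix.toBlocks₂₂,
        velocityEquiv, velocityBlock, fieldBlock, Amat]

lemma det_symbol_eq_zero (ρ γ p : ℝ) (H ξ : Fin 3 → ℝ) (hρ : ρ ≠ 0) :
    (Amat ρ γ p H ξ).det = 0 := by
  refine Matrix.exists_vecMul_eq_zero_iff.mp ⟨![γ * p, 0, 0, 0, 0, 0, 0, -ρ], ?_, ?_⟩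
  · intro h
    exact hρ (by simpa using congrFun h 7)
  · ext j
    fin_cases j <;> simp [Matrix.vecMul, dotProduct, Fin.sum_univ_succ, Amat] <;> ring

lemma det_symbol {ρ γ p : ℝ} (H ξ : Fin 3 → ℝ) (hρ : 0 < ρ) (hγp : 0 < γ * p) (τ : ℝ) :
    (τ • (1 : Matrix (Fin 8) (Fin 8) ℝ) + Amat ρ γ p H ξ).det
      = τ ^ 2 * (τ ^ 2 - cs2 ρ γ p H ξ)
          * (τ ^ 2 - (dot3 H ξ) ^ 2 / ρ) * (τ ^ 2 - cf2 ρ γ p H ξ) := by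
  rcases eq_or_ne τ 0 with rfl | hτ
  · simp [det_symbol_eq_zero ρ γ p H ξ hρ.ne']
  have hquad : (τ ^ 2 - cs2 ρ γ p H ξ) * (τ ^ 2 - cf2 ρ γ p H ξ)
      = τ ^ 4 - (csq ρ γ p + hsq ρ H) * dot3 ξ ξ * τ ^ 2
        + csq ρ γ p * (dot3 H ξ ^ 2 / ρ) * dot3 ξ ξ := by
    linear_combination (-τ ^ 2) * cs2_add_cf2 ρ γ p H ξ + cs2_mul_cf2 H ξ hρ hγp
  let _ : Invertible (τ • (1 : Matrix (Fin 5) (Fin 5) ℝ)) :=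
    ⟨τ⁻¹ • 1, by simp [smul_smul, hτ], by simp [smul_smul, hτ]⟩
  have hinvOf : ⅟(τ • (1 : Matrix (Fin 5) (Fin 5) ℝ)) = τ⁻¹ • 1 := rfl
  rw [← Matrix.det_submatrix_equiv_self velocityEquiv, submatrix_velocityEquiv,
    Matrix.det_fromBlocks₂₂, hinvOf, Matrix.mul_smul, Matrix.mul_one, Matrix.smul_mul,
    velocityBlock_mul_fieldBlock, Matrix.det_smul, Matrix.det_one, Fintype.card_fin]
  calc
    _ = τ ^ 2 * (τ ^ 2 - dot3 H ξ ^ 2 / ρ) *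
        (τ ^ 4 - (csq ρ γ p + hsq ρ H) * dot3 ξ ξ * τ ^ 2
          + csq ρ γ p * (dot3 H ξ ^ 2 / ρ) * dot3 ξ ξ) := by
      rw [Matrix.det_fin_three]
      simp [csq, hsq, dot3]
      field_simp
      ring
    _ = _ := by
      rw [← hquad]
      ring

lemma eval_charpoly_neg {n R : Type*} [Fintype n] [DecidableEq n] [CommRing R]
    (A : Matrix n n R) (τ : R) :
    Polynomial.eval τ (-A).charpoly = (τ • (1 : Matrix n n R) + A).det := by
  rw [Matrix.eval_charpoly, sub_neg_eq_add, Matrix.scalar_apply, Matrix.smul_one_eq_diagonal]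

/-- The nonzero characteristic speeds. -/
def speeds (ρ γ p : ℝ) (H ξ : Fin 3 → ℝ) : List ℝ :=
  [Real.sqrt (cs2 ρ γ p H ξ), -Real.sqrt (cs2 ρ γ p H ξ),
    dot3 H ξ / Real.sqrt ρ, -(dot3 H ξ / Real.sqrt ρ),
    Real.sqrt (cf2 ρ γ p H ξ), -Real.sqrt (cf2 ρ γ p H ξ)]

lemma pairwise_ne_signed_of_sq_lt {x y z : ℝ} (hx : 0 < x ^ 2) (hxy : x ^ 2 < y ^ 2)
    (hyz : y ^ 2 < z ^ 2) : [x, -x, y, -y, z, -z].Pairwise (· ≠ ·) := by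
  have key : ∀ {u v : ℝ}, u ^ 2 < v ^ 2 → u ≠ v := fun h e => h.ne (by rw [e])
  have self : ∀ {u : ℝ}, 0 < u ^ 2 → u ≠ -u := fun h e => by
    have : _ = (0 : ℝ) := self_eq_neg.mp e
    simp [this] at h
  have hxz := hxy.trans hyz
  simp only [List.pairwise_cons, List.mem_cons, List.not_mem_nil, or_false, forall_eq_or_imp,
    forall_eq, IsEmpty.forall_iff, implies_true, List.Pairwise.nil, and_true]
  refine ⟨⟨self hx, ?_, ?_, ?_, ?_⟩, ⟨?_, ?_, ?_, ?_⟩, ⟨self (hx.trans hxy), ?_, ?_⟩, ⟨?_, ?_⟩,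
    self (hx.trans hxz)⟩
  all_goals exact key (by simpa only [neg_sq])

lemma roots_charpoly_neg_Amat {ρ γ p : ℝ} {H ξ : Fin 3 → ℝ} (hρ : 0 < ρ) (hγp : 0 < γ * p)
    (hs : 0 ≤ cs2 ρ γ p H ξ) (hf : 0 ≤ cf2 ρ γ p H ξ) :
    (-(Amat ρ γ p H ξ)).charpoly.roots = 0 ::ₘ 0 ::ₘ (speeds ρ γ p H ξ : Multiset ℝ) := by
  rw [← Polynomial.roots_multiset_prod_X_sub_C (0 ::ₘ 0 ::ₘ (speeds ρ γ p H ξ : Multiset ℝ))]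
  congr 1
  refine Polynomial.funext fun τ => ?_
  rw [eval_charpoly_neg, det_symbol H ξ hρ hγp]
  have ha : (dot3 H ξ / Real.sqrt ρ) ^ 2 = dot3 H ξ ^ 2 / ρ := by
    rw [div_pow, Real.sq_sqrt hρ.le]
  rw [← ha]
  nth_rewrite 1 [← Real.sq_sqrt hs, ← Real.sq_sqrt hf]
  simp [speeds]
  ring

/-- Under `0 < |H|²`, `|H|² ≠ γp`, `H·ξ ≠ 0`, `ξ×H ≠ 0`: the characteristic
polynomial `det(τ·Id₈ + A(ξ))` (which is `charpoly(−A(ξ))` evaluated at `τ`)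
equals `τ²·(τ² − c_s²(ξ))·(τ² − (H·ξ)²/ρ)·(τ² − c_f²(ξ))`, the six numbers
`±√(c_s²(ξ)), ±(H·ξ)/√ρ, ±√(c_f²(ξ))` are nonzero and pairwise distinct, `0` is
a root of multiplicity exactly `2`, and every nonzero root is simple. -/
theorem stmt18 (ρ γ p : ℝ) (H ξ : Fin 3 → ℝ)
    (hρ : 0 < ρ) (hγp : 0 < γ * p)
    (hH : 0 < dot3 H H) (hHne : dot3 H H ≠ γ * p)
    (hHξ : dot3 H ξ ≠ 0) (hcross : cross3 ξ H ≠ 0) :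
    (∀ τ : ℝ,
      (τ • (1 : Matrix (Fin 8) (Fin 8) ℝ) + Amat ρ γ p H ξ).det
        = τ ^ 2 * (τ ^ 2 - cs2 ρ γ p H ξ)
            * (τ ^ 2 - (dot3 H ξ) ^ 2 / ρ) * (τ ^ 2 - cf2 ρ γ p H ξ)) ∧
    (∀ τ : ℝ,
      Polynomial.eval τ (-(Amat ρ γ p H ξ)).charpoly
        = (τ • (1 : Matrix (Fin 8) (Fin 8) ℝ) + Amat ρ γ p H ξ).det) ∧
    ([Real.sqrt (cs2 ρ γ p H ξ), -Real.sqrt (cs2 ρ γ p H ξ),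
        dot3 H ξ / Real.sqrt ρ, -(dot3 H ξ / Real.sqrt ρ),
        Real.sqrt (cf2 ρ γ p H ξ), -Real.sqrt (cf2 ρ γ p H ξ)] : List ℝ).Pairwise
      (· ≠ ·) ∧
    (∀ x ∈ ([Real.sqrt (cs2 ρ γ p H ξ), -Real.sqrt (cs2 ρ γ p H ξ),
        dot3 H ξ / Real.sqrt ρ, -(dot3 H ξ / Real.sqrt ρ),
        Real.sqrt (cf2 ρ γ p H ξ), -Real.sqrt (cf2 ρ γ p H ξ)] : List ℝ), x ≠ 0) ∧
    Polynomial.rootMultiplicity 0 (-(Amat ρ γ p H ξ)).charpoly = 2 ∧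
    (∀ t : ℝ, t ≠ 0 → (-(Amat ρ γ p H ξ)).charpoly.IsRoot t →
      Polynomial.rootMultiplicity t (-(Amat ρ γ p H ξ)).charpoly = 1) := by
  obtain ⟨hs, hsa, haf⟩ := magnetosonic_speeds_lt hρ hγp hHξ hcross
  have ha : (dot3 H ξ / Real.sqrt ρ) ^ 2 = dot3 H ξ ^ 2 / ρ := by
    rw [div_pow, Real.sq_sqrt hρ.le]
  have hf := hs.trans (hsa.trans haf)
  have hs2 := Real.sq_sqrt hs.le
  have hf2 := Real.sq_sqrt hf.le
  have hnodup : (speeds ρ γ p H ξ).Pairwise (· ≠ ·) :=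
    pairwise_ne_signed_of_sq_lt (by rwa [hs2]) (by rwa [hs2, ha]) (by rwa [ha, hf2])
  have hne : ∀ x ∈ speeds ρ γ p H ξ, x ≠ 0 := by
    have h1 := (Real.sqrt_pos.mpr hs).ne'
    have h2 := div_ne_zero hHξ (Real.sqrt_pos.mpr hρ).ne'
    have h3 := (Real.sqrt_pos.mpr hf).ne'
    simp only [speeds, List.mem_cons, List.not_mem_nil, or_false, forall_eq_or_imp, forall_eq]
    exact ⟨h1, neg_ne_zero.mpr h1, h2, neg_ne_zero.mpr h2, h3, neg_ne_zero.mpr h3⟩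
  have hroots := roots_charpoly_neg_Amat hρ hγp hs.le hf.le
  refine ⟨det_symbol H ξ hρ hγp, eval_charpoly_neg _, hnodup, hne, ?_, fun t ht hroot => ?_⟩
  · rw [← Polynomial.count_roots, hroots, Multiset.count_cons_self, Multiset.count_cons_self,
      Multiset.count_eq_zero_of_notMem fun h => hne 0 (Multiset.mem_coe.mp h) rfl]
  · have hmem := (Polynomial.mem_roots (Matrix.charpoly_monic _).ne_zero).mpr hroot
    simp only [hroots, Multiset.mem_cons, ht, false_or] at hmem
    rw [← Polynomial.count_roots, hroots, Multiset.count_cons_of_ne ht,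
      Multiset.count_cons_of_ne ht]
    exact Multiset.count_eq_one_of_mem (Multiset.coe_nodup.mpr hnodup) hmem
end
end
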